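/- Consider the model y = Xβ* + ε with ε ~ N(0, σ²I_n), where β* has support of cardinality s and columns of X satisfy ‖X_j‖₂² = n. Suppose X satisfies the restricted eigenvalue condition RE(3, s) and λ = 6σ√(2 log(p/δ)/n) for δ ∈ (0,1). Let β̂ be a Lasso solution with tuning parameter λ and let β̄ be any sign-consistent refitting of β̂. Then with probability at least 1 − δ, (1/n)‖X(β* − β̄)‖₂² + (1/n)‖X(β* − β̂)‖₂² ≤ λ²s( 9/κ²(3, s) + 16/κ²(1, s) ). -/

import Mathlib

open MeasureTheory ProbabilityTheory Finset

noncomputable section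

/-- Product Gaussian measure `N(0, σ² I_n)` on `ℝⁿ`. -/
def gaussianVec (n : ℕ) (σ : ℝ) : Measure (Fin n → ℝ) :=
  Measure.pi fun _ => gaussianReal 0 (σ ^ 2).toNNReal

/-- Squared Euclidean norm. -/
def l2sq {m : ℕ} (v : Fin m → ℝ) : ℝ := ∑ i, (v i) ^ 2

/-- Euclidean norm. -/
def l2 {m : ℕ} (v : Fin m → ℝ) : ℝ := Real.sqrt (l2sq v)

/-- ℓ₁ norm. -/
def l1 {m : ℕ} (v : Fin m → ℝ) : ℝ := ∑ i, |v i|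

/-- Lasso objective `(1/2n)‖y − Xβ‖₂² + λ‖β‖₁`. -/
def lassoObj {n p : ℕ} (X : Matrix (Fin n) (Fin p) ℝ) (y : Fin n → ℝ) (lam : ℝ)
    (β : Fin p → ℝ) : ℝ :=
  l2sq (y - X.mulVec β) / (2 * (n : ℝ)) + lam * l1 β

/-- `b` is a Lasso solution with tuning parameter `lam`. -/
def IsLassoSol {n p : ℕ} (X : Matrix (Fin n) (Fin p) ℝ) (y : Fin n → ℝ) (lam : ℝ)
    (b : Fin p → ℝ) : Prop :=
  ∀ β : Fin p → ℝ, lassoObj X y lam b ≤ lassoObj X y lam β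

/-- Restricted eigenvalue condition RE(c₀, s) with constant `κ`:
for every `J` with `|J| ≤ s` and every `Δ` with `‖Δ_{Jᶜ}‖₁ ≤ c₀‖Δ_J‖₁`,
one has `‖XΔ‖₂² ≥ κ² n ‖Δ_J‖₂²`. -/
def RE {n p : ℕ} (X : Matrix (Fin n) (Fin p) ℝ) (c0 : ℝ) (s : ℕ) (κ : ℝ) : Prop :=
  0 < κ ∧ ∀ J : Finset (Fin p), J.card ≤ s → ∀ Δ : Fin p → ℝ,
    (∑ j ∈ Jᶜ, |Δ j|) ≤ c0 * ∑ j ∈ J, |Δ j| →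
    κ ^ 2 * ((n : ℝ) * ∑ j ∈ J, (Δ j) ^ 2) ≤ l2sq (X.mulVec Δ)

/-- The Lasso subgradient `ρ̂ = Xᵀ(y − Xβ̂)/(λ n)`. -/
def lassoSubgrad {n p : ℕ} (X : Matrix (Fin n) (Fin p) ℝ) (y : Fin n → ℝ) (lam : ℝ)
    (b : Fin p → ℝ) : Fin p → ℝ :=
  fun j => (X.transpose.mulVec (y - X.mulVec b)) j / (lam * (n : ℝ))

/-- Boosted Lasso objective `(1/2n)‖y − Xβ‖₂² + λ₂‖β − β̂‖₁`. -/
def boostedObj {n p : ℕ} (X : Matrix (Fin n) (Fin p) ℝ) (y : Fin n → ℝ) (lam2 : ℝ)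
    (bhat β : Fin p → ℝ) : ℝ :=
  l2sq (y - X.mulVec β) / (2 * (n : ℝ)) + lam2 * l1 (β - bhat)

/-- `b` is a Boosted Lasso solution built upon the first-step estimator `bhat`. -/
def IsBoostedSol {n p : ℕ} (X : Matrix (Fin n) (Fin p) ℝ) (y : Fin n → ℝ) (lam2 : ℝ)
    (bhat b : Fin p → ℝ) : Prop :=
  ∀ β : Fin p → ℝ, boostedObj X y lam2 bhat b ≤ boostedObj X y lam2 bhat β

/-- Bregman Lasso objective
`(1/2n)‖y − Xβ‖₂² + λ₂(‖β‖₁ − ⟨ρ̂^{λ₁}, β⟩)` where `ρ̂^{λ₁}` is the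
Lasso subgradient associated with `bhat`. -/
def bregmanObj {n p : ℕ} (X : Matrix (Fin n) (Fin p) ℝ) (y : Fin n → ℝ) (lam1 lam2 : ℝ)
    (bhat β : Fin p → ℝ) : ℝ :=
  l2sq (y - X.mulVec β) / (2 * (n : ℝ)) +
    lam2 * (l1 β - ∑ j, lassoSubgrad X y lam1 bhat j * β j)

/-- `b` is a Bregman Lasso solution with parameters `(lam1, lam2)`. -/
def IsBregmanSol {n p : ℕ} (X : Matrix (Fin n) (Fin p) ℝ) (y : Fin n → ℝ) (lam1 lam2 : ℝ)
    (bhat b : Fin p → ℝ) : Prop :=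
  ∀ β : Fin p → ℝ, bregmanObj X y lam1 lam2 bhat b ≤ bregmanObj X y lam1 lam2 bhat β

/-- `bbar` is a sign-consistent refitting of the Lasso solution `bhat`:
it does not increase the residual norm and `(1/n)Xᵀ(y − Xβ̂) ∈ λ·sign(β̄)`
componentwise. -/
def SignConsistentRefit {n p : ℕ} (X : Matrix (Fin n) (Fin p) ℝ) (y : Fin n → ℝ) (lam : ℝ)
    (bhat bbar : Fin p → ℝ) : Prop :=
  l2 (y - X.mulVec bbar) ≤ l2 (y - X.mulVec bhat) ∧
  ∀ j, (0 < bbar j → X.transpose.mulVec (y - X.mulVec bhat) j / (n : ℝ) = lam) ∧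
       (bbar j < 0 → X.transpose.mulVec (y - X.mulVec bhat) j / (n : ℝ) = -lam) ∧
       (bbar j = 0 → |X.transpose.mulVec (y - X.mulVec bhat) j / (n : ℝ)| ≤ lam)

/-- `bbar` is a Sign-Least-Squares Lasso refitting of the Lasso solution `bhat`:
it vanishes outside the equicorrelation set `E = {j : |ρ̂_j| = 1}` and minimizes
the residual sum of squares among all vectors supported on `E` whose coordinates
have signs compatible with `ρ̂_E`. -/
def IsSLSSol {n p : ℕ} (X : Matrix (Fin n) (Fin p) ℝ) (y : Fin n → ℝ) (lam : ℝ)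
    (bhat bbar : Fin p → ℝ) : Prop :=
  (∀ j, |lassoSubgrad X y lam bhat j| ≠ 1 → bbar j = 0) ∧
  (∀ j, 0 ≤ lassoSubgrad X y lam bhat j * bbar j) ∧
  ∀ β : Fin p → ℝ,
    ((∀ j, |lassoSubgrad X y lam bhat j| ≠ 1 → β j = 0) ∧
     (∀ j, 0 ≤ lassoSubgrad X y lam bhat j * β j)) →
    l2sq (y - X.mulVec bbar) ≤ l2sq (y - X.mulVec β)

/-- Componentwise soft-thresholding operator `softThresh(y, λ)_j = sign(y_j)(|y_j| − λ)₊`. -/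
def softThresh {p : ℕ} (y : Fin p → ℝ) (lam : ℝ) : Fin p → ℝ :=
  fun j => Real.sign (y j) * max (|y j| - lam) 0

/-- Componentwise firm-thresholding (MCP) operator. -/
def MCP {p : ℕ} (y : Fin p → ℝ) (μ γ : ℝ) : Fin p → ℝ :=
  fun j => if |y j| ≤ μ * γ then γ / (γ - 1) * (Real.sign (y j) * max (|y j| - μ) 0) else y j

/-- Bregman objective in the denoising (orthogonal, `X = I_p`) case:
`(1/2)‖y − β‖₂² + λ(‖β‖₁ − ⟨ρ, β⟩)`. -/
def denoiseBregObj {p : ℕ} (y ρ : Fin p → ℝ) (lam : ℝ) (β : Fin p → ℝ) : ℝ :=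
  (1 / 2) * l2sq (y - β) + lam * (l1 β - ∑ j, ρ j * β j)

end

open scoped NNReal ENNReal

/-- A shifted half-line carries at most `exp (-t² / (2v))` times the mass of the half-line at `0`. -/
lemma gaussianReal_Ioi_le {v : ℝ≥0} (hv : v ≠ 0) {t : ℝ} (ht : 0 ≤ t) :
    gaussianReal 0 v (Set.Ioi t) ≤
      ENNReal.ofReal (Real.exp (-t ^ 2 / (2 * v))) * gaussianReal 0 v (Set.Ioi 0) := by
  rw [gaussianReal_apply _ hv, gaussianReal_apply _ hv,
    ← lintegral_const_mul _ (measurable_gaussianPDF 0 v),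
    ← lintegral_indicator measurableSet_Ioi, ← lintegral_indicator measurableSet_Ioi,
    ← lintegral_add_right_eq_self (μ := volume) _ t]
  refine lintegral_mono fun x => ?_
  simp only [Set.indicator_apply, Set.mem_Ioi, lt_add_iff_pos_left]
  split_ifs with hx
  · rw [gaussianPDF, gaussianPDF, ← ENNReal.ofReal_mul (Real.exp_nonneg _)]
    refine ENNReal.ofReal_le_ofReal ?_
    rw [gaussianPDFReal, gaussianPDFReal, mul_left_comm, ← Real.exp_add, ← add_div]
    have hv' : (0 : ℝ) < v := NNReal.coe_pos.2 (pos_iff_ne_zero.2 hv)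
    gcongr
    nlinarith [mul_nonneg hx.le ht]
  · exact le_rfl

lemma gaussianReal_abs_gt_le {v : ℝ≥0} (hv : v ≠ 0) {t : ℝ} (ht : 0 ≤ t) :
    gaussianReal 0 v {x | t < |x|} ≤ ENNReal.ofReal (Real.exp (-t ^ 2 / (2 * v))) := by
  have hneg : ∀ u : ℝ, gaussianReal 0 v (Set.Iio (-u)) = gaussianReal 0 v (Set.Ioi u) := by
    intro u
    have h : gaussianReal 0 v = (gaussianReal 0 v).map (fun x => -x) := by
      rw [gaussianReal_map_neg, neg_zero]
    conv_lhs => rw [h]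
    rw [Measure.map_apply measurable_neg measurableSet_Iio]
    congr 1
    ext x
    simp
  have hset : {x : ℝ | t < |x|} = Set.Ioi t ∪ Set.Iio (-t) := by
    ext x
    simp [lt_abs, lt_neg]
  have hhalf : gaussianReal 0 v (Set.Ioi 0) + gaussianReal 0 v (Set.Iio 0) ≤ 1 := by
    have hdisj : Disjoint (Set.Ioi (0 : ℝ)) (Set.Iio 0) :=
      Set.disjoint_left.2 fun x hx hx' => lt_asymm (Set.mem_Ioi.1 hx) (Set.mem_Iio.1 hx')
    rw [← measure_union hdisj measurableSet_Iio]
    exact prob_le_one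
  have h0 := hneg 0
  rw [neg_zero] at h0
  calc gaussianReal 0 v {x | t < |x|}
      ≤ gaussianReal 0 v (Set.Ioi t) + gaussianReal 0 v (Set.Iio (-t)) := by
        rw [hset]
        exact measure_union_le _ _
    _ ≤ ENNReal.ofReal (Real.exp (-t ^ 2 / (2 * v))) *
          (gaussianReal 0 v (Set.Ioi 0) + gaussianReal 0 v (Set.Iio 0)) := by
        rw [hneg, h0, mul_add]
        exact add_le_add (gaussianReal_Ioi_le hv ht) (gaussianReal_Ioi_le hv ht)
    _ ≤ _ := mul_le_of_le_one_right' hhalf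

instance (n : ℕ) (σ : ℝ) : IsProbabilityMeasure (gaussianVec n σ) := by
  unfold gaussianVec
  infer_instance

lemma gaussianVec_map_sum (n : ℕ) (σ : ℝ) (a : Fin n → ℝ) (t : Finset (Fin n)) :
    (gaussianVec n σ).map (fun ε => ∑ i ∈ t, a i * ε i) =
      gaussianReal 0 ((∑ i ∈ t, (a i) ^ 2) * σ ^ 2).toNNReal := by
  have hindep : iIndepFun (fun i (ε : Fin n → ℝ) => a i * ε i) (gaussianVec n σ) :=
    iIndepFun_pi (X := fun i x => a i * x) fun i => by fun_prop
  induction t using Finset.induction_on with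
  | empty => simp [Measure.map_const]
  | insert i t hi ih =>
    have hone : (gaussianVec n σ).map (fun ε => a i * ε i) =
        gaussianReal 0 ((a i) ^ 2 * σ ^ 2).toNNReal := by
      have h : (gaussianVec n σ).map (fun ε => ε i) = gaussianReal 0 (σ ^ 2).toNNReal := by
        unfold gaussianVec
        exact (measurePreserving_eval _ i).map_eq
      have h' : (gaussianVec n σ).map (fun ε => a i * ε i) =
          ((gaussianVec n σ).map (fun ε => ε i)).map (fun x => a i * x) := by
        rw [Measure.map_map (by fun_prop) (by fun_prop)]
        rfl
      rw [h', h, gaussianReal_map_const_mul, mul_zero]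
      congr 1
      rw [Real.toNNReal_mul (sq_nonneg _)]
      congr 1
      ext
      simp [sq_nonneg]
    have hadd := gaussianReal_add_gaussianReal_of_indepFun
      ((hindep.indepFun_finsetSum_of_notMem (fun i => by fun_prop) hi).symm) hone
      (by rw [← ih]; congr 1; ext ε; simp)
    rw [add_zero, ← Real.toNNReal_add (by positivity) (by positivity), ← add_mul] at hadd
    rw [Finset.sum_insert hi, ← hadd]
    congr 1
    ext ε
    simp [Finset.sum_insert hi]

lemma gaussianVec_noise_le {n p : ℕ} (hn : 0 < n) (hp : 0 < p) {σ : ℝ} (hσ : 0 < σ)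
    (X : Matrix (Fin n) (Fin p) ℝ) (hX : ∀ j, ∑ i, (X i j) ^ 2 = (n : ℝ))
    {δ : ℝ} (hδ : δ ∈ Set.Ioo (0 : ℝ) 1) :
    ENNReal.ofReal (1 - δ) ≤ gaussianVec n σ
      {ε | ∀ j, |X.transpose.mulVec ε j / n| ≤
        σ * Real.sqrt (2 * Real.log ((p : ℝ) / δ) / (n : ℝ))} := by
  obtain ⟨hδ0, hδ1⟩ := hδ
  have hn' : (0 : ℝ) < n := Nat.cast_pos.2 hn
  have hp' : (1 : ℝ) ≤ p := Nat.one_le_cast.2 hp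
  have hlog : 0 ≤ Real.log ((p : ℝ) / δ) :=
    Real.log_nonneg ((one_le_div hδ0).2 (hδ1.le.trans hp'))
  set τ := σ * Real.sqrt (2 * Real.log ((p : ℝ) / δ) / (n : ℝ)) with hτ
  have hτ0 : 0 ≤ τ := by positivity
  set G : Set (Fin n → ℝ) := {ε | ∀ j, |X.transpose.mulVec ε j / n| ≤ τ} with hG
  set B : Fin p → Set (Fin n → ℝ) := fun j => {ε | n * τ < |∑ i, X i j * ε i|} with hB
  have hBmeas : ∀ j, MeasurableSet (B j) := fun j =>
    measurableSet_lt (by fun_prop) (by fun_prop)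
  have hGB : G = (⋃ j, B j)ᶜ := by
    ext ε
    simp only [hG, hB, Set.mem_ofPred_eq, Set.mem_compl_iff, Set.mem_iUnion, not_exists, not_lt]
    refine forall_congr' fun j => ?_
    rw [abs_div, abs_of_pos hn', div_le_iff₀ hn', mul_comm τ]
    rfl
  have hBle : ∀ j, gaussianVec n σ (B j) ≤ ENNReal.ofReal (δ / p) := by
    intro j
    have hv : ((n : ℝ) * σ ^ 2).toNNReal ≠ 0 := by
      simpa using by positivity
    have hmap := gaussianVec_map_sum n σ (fun i => X i j) Finset.univ
    rw [hX j] at hmap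
    have hBeq : gaussianVec n σ (B j) =
        gaussianReal 0 ((n : ℝ) * σ ^ 2).toNNReal {x | n * τ < |x|} := by
      rw [← hmap, Measure.map_apply (by fun_prop) (measurableSet_lt (by fun_prop) (by fun_prop))]
      rfl
    rw [hBeq]
    refine (gaussianReal_abs_gt_le hv (by positivity)).trans_eq ?_
    congr 1
    have hexp : -(n * τ) ^ 2 / (2 * (((n : ℝ) * σ ^ 2).toNNReal : ℝ)) =
        -Real.log ((p : ℝ) / δ) := by
      rw [Real.coe_toNNReal _ (by positivity), hτ, mul_pow, mul_pow, Real.sq_sqrt (by positivity)]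
      field_simp
    rw [hexp, Real.exp_neg, Real.exp_log (by positivity), inv_div]
  have hU : gaussianVec n σ (⋃ j, B j) ≤ ENNReal.ofReal δ := by
    refine (measure_iUnion_fintype_le _ _).trans ((Finset.sum_le_sum fun j _ => hBle j).trans ?_)
    rw [Finset.sum_const, Finset.card_univ, Fintype.card_fin, nsmul_eq_mul,
      ← ENNReal.ofReal_natCast, ← ENNReal.ofReal_mul (by positivity)]
    rw [mul_div_cancel₀ _ (by positivity)]
  rw [hGB, prob_compl_eq_one_sub (MeasurableSet.iUnion hBmeas), ENNReal.ofReal_sub _ hδ0.le,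
    ENNReal.ofReal_one]
  exact tsub_le_tsub_left hU _

lemma l2sq_eq_dotProduct {m : ℕ} (v : Fin m → ℝ) : l2sq v = v ⬝ᵥ v := by
  simp [l2sq, dotProduct, sq]

lemma l2sq_nonneg {m : ℕ} (v : Fin m → ℝ) : 0 ≤ l2sq v :=
  Finset.sum_nonneg fun _ _ => sq_nonneg _

/-- The complementary slackness inequality of a Lasso solution. -/
lemma IsLassoSol.mul_l1_le {n p : ℕ} (hn : 0 < n) {X : Matrix (Fin n) (Fin p) ℝ} {y : Fin n → ℝ}
    {lam : ℝ} {b : Fin p → ℝ} (hb : IsLassoSol X y lam b) :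
    lam * l1 b ≤ (y - X.mulVec b) ⬝ᵥ X.mulVec b / n := by
  have hn' : (0 : ℝ) < n := Nat.cast_pos.2 hn
  set r := y - X.mulVec b with hr
  set q := l2sq (X.mulVec b) / (2 * n) with hq
  have key : ∀ t ∈ Set.Ioc (0 : ℝ) 1, lam * l1 b ≤ r ⬝ᵥ X.mulVec b / n + t * q := by
    rintro t ⟨ht0, ht1⟩
    have h := hb ((1 - t) • b)
    have hres : y - X.mulVec ((1 - t) • b) = r + t • X.mulVec b := by
      rw [hr, Matrix.mulVec_smul, sub_smul, one_smul]
      abel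
    have hl1 : l1 ((1 - t) • b) = (1 - t) * l1 b := by
      simp [l1, Finset.mul_sum, abs_mul, abs_of_nonneg (sub_nonneg.2 ht1)]
    have hsq : l2sq (r + t • X.mulVec b) =
        l2sq r + 2 * t * (r ⬝ᵥ X.mulVec b) + t ^ 2 * l2sq (X.mulVec b) := by
      simp only [l2sq_eq_dotProduct, add_dotProduct, dotProduct_add, smul_dotProduct,
        dotProduct_smul, smul_eq_mul]
      rw [dotProduct_comm (X.mulVec b) r]
      ring
    rw [lassoObj, lassoObj, hres, hl1, hsq, ← hr] at h
    have hsplit : (l2sq r + 2 * t * (r ⬝ᵥ X.mulVec b) + t ^ 2 * l2sq (X.mulVec b)) / (2 * n) =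
        l2sq r / (2 * n) + t * (r ⬝ᵥ X.mulVec b / n) + t * (t * q) := by
      rw [hq]
      field_simp
    rw [hsplit] at h
    refine le_of_mul_le_mul_left ?_ ht0
    linarith
  have hlim : Filter.Tendsto (fun t : ℝ => r ⬝ᵥ X.mulVec b / n + t * q) (nhdsWithin 0 (Set.Ioi 0))
      (nhds (r ⬝ᵥ X.mulVec b / n)) := by
    have hc : Continuous fun t : ℝ => r ⬝ᵥ X.mulVec b / n + t * q := by fun_prop
    simpa using (hc.tendsto 0).mono_left nhdsWithin_le_nhds
  exact ge_of_tendsto hlim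
    (Filter.eventually_of_mem (Ioc_mem_nhdsGT one_pos) key)

/-- A subgradient-type vector at `b` controls the error off the support of `bstar`. -/
lemma mul_sub_le_dotProduct_sub {p : ℕ} {lam : ℝ} {g b bstar : Fin p → ℝ}
    (hg : ∀ j, |g j| ≤ lam) (hgb : lam * l1 b ≤ g ⬝ᵥ b)
    {S : Finset (Fin p)} (hS : ∀ j ∉ S, bstar j = 0) :
    lam * (∑ j ∈ Sᶜ, |(b - bstar) j| - ∑ j ∈ S, |(b - bstar) j|) ≤ g ⬝ᵥ (b - bstar) := by
  have h1 : lam * ∑ j ∈ Sᶜ, |(b - bstar) j| = ∑ j ∈ Sᶜ, (lam * |b j| - g j * bstar j) := by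
    rw [Finset.mul_sum]
    refine Finset.sum_congr rfl fun j hj => ?_
    simp [hS j (Finset.mem_compl.1 hj)]
  have h2 : -(lam * ∑ j ∈ S, |(b - bstar) j|) ≤ ∑ j ∈ S, (lam * |b j| - g j * bstar j) := by
    rw [Finset.mul_sum, ← Finset.sum_neg_distrib]
    refine Finset.sum_le_sum fun j _ => ?_
    have hlam : 0 ≤ lam := (abs_nonneg _).trans (hg j)
    have hle : g j * bstar j ≤ lam * |bstar j| :=
      (le_abs_self _).trans (by rw [abs_mul]; exact mul_le_mul_of_nonneg_right (hg j) (abs_nonneg _))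
    have htri : |bstar j| ≤ |b j| + |(b - bstar) j| := by
      rw [Pi.sub_apply, abs_sub_comm]
      linarith [abs_sub_abs_le_abs_sub (bstar j) (b j)]
    linarith [mul_le_mul_of_nonneg_left htri hlam]
  have h3 : ∑ j ∈ S, (lam * |b j| - g j * bstar j) + ∑ j ∈ Sᶜ, (lam * |b j| - g j * bstar j) =
      lam * l1 b - g ⬝ᵥ bstar := by
    rw [Finset.sum_add_sum_compl, Finset.sum_sub_distrib, l1, Finset.mul_sum, dotProduct]
  rw [dotProduct_sub]
  linarith

/-- The `ℓ₁` norm of `Δ` on `J` is controlled by the prediction norm under `RE`. -/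
lemma RE.sum_abs_le {n p s : ℕ} (hn : 0 < n) {X : Matrix (Fin n) (Fin p) ℝ} {c0 κ : ℝ}
    (h : RE X c0 s κ) {J : Finset (Fin p)} (hJ : J.card ≤ s) {Δ : Fin p → ℝ}
    (hΔ : ∑ j ∈ Jᶜ, |Δ j| ≤ c0 * ∑ j ∈ J, |Δ j|) :
    (∑ j ∈ J, |Δ j|) ^ 2 ≤ s * (1 / κ ^ 2) * (l2sq (X.mulVec Δ) / n) := by
  obtain ⟨hκ, hRE⟩ := h
  have hn' : (0 : ℝ) < n := Nat.cast_pos.2 hn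
  have hre := hRE J hJ Δ hΔ
  have hcs : (∑ j ∈ J, |Δ j|) ^ 2 ≤ J.card * ∑ j ∈ J, (Δ j) ^ 2 := by
    simpa using sq_sum_le_card_mul_sum_sq (s := J) (f := fun j => |Δ j|)
  have hsum : ∑ j ∈ J, (Δ j) ^ 2 ≤ (1 / κ ^ 2) * (l2sq (X.mulVec Δ) / n) := by
    rw [div_mul_div_comm, one_mul, le_div_iff₀ (by positivity)]
    linarith
  calc _ ≤ _ := hcs
    _ ≤ s * ∑ j ∈ J, (Δ j) ^ 2 := by
      gcongr
    _ ≤ s * ((1 / κ ^ 2) * (l2sq (X.mulVec Δ) / n)) := by gcongr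
    _ = _ := by ring

/-- The scalar core of the oracle inequality: `a`, `b` are the prediction errors of the refitting
and of the Lasso, `A`, `B` (resp. `C`, `D`) the `ℓ₁` errors off and on the support. -/
lemma add_le_of_cone_bounds {a b A B C D lam u w : ℝ} (ha : 0 ≤ a) (hb : 0 ≤ b)
    (hB : 0 ≤ B) (hC : 0 ≤ C) (hD : 0 ≤ D) (hlam : 0 < lam) (hu : 0 ≤ u) (hw : 0 ≤ w)
    (hab : a + b ≤ lam / 3 * (A + B) + 2 * lam * (D - C))
    (hcone : A ≤ 2 * B + 3 / 2 * (D - C))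
    (h3 : A ≤ 3 * B → B ^ 2 ≤ u * a) (h1 : C ≤ D → D ^ 2 ≤ w * b) :
    a + b ≤ lam ^ 2 * (9 * u + 16 * w) := by
  have hlu : 0 ≤ lam ^ 2 * u := by positivity
  have hlw : 0 ≤ lam ^ 2 * w := by positivity
  have amgm : ∀ {x c z k : ℝ}, 0 ≤ x → 0 ≤ z → 0 ≤ c → 0 ≤ k → x ^ 2 ≤ c * z →
      k * lam * x ≤ z / 2 + k ^ 2 / 2 * (lam ^ 2 * c) := by
    intro x c z k hx hz hc hk hxz
    have : (k * lam * x) ^ 2 ≤ (z / 2 + k ^ 2 / 2 * (lam ^ 2 * c)) ^ 2 := by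
      have := mul_le_mul_of_nonneg_left hxz (by positivity : 0 ≤ k ^ 2 * lam ^ 2)
      nlinarith [sq_nonneg (z / 2 - k ^ 2 / 2 * (lam ^ 2 * c))]
    exact le_of_sq_le_sq this (by positivity)
  rcases le_total D C with hDC | hCD
  · have hA : A ≤ 2 * B := by linarith
    have hx := amgm hB ha hu zero_le_one (h3 (by linarith))
    nlinarith [mul_nonneg hlam.le (sub_nonneg.2 hDC), mul_nonneg hlam.le (sub_nonneg.2 hA)]
  · rcases le_or_gt A (3 * B) with hA | hA
    · have hx := amgm hB ha hu (by norm_num : (0 : ℝ) ≤ 4 / 3) (h3 hA)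
      have hy := amgm hD hb hw (by norm_num : (0 : ℝ) ≤ 2) (h1 hCD)
      nlinarith [mul_nonneg hlam.le (sub_nonneg.2 hA), mul_nonneg hlam.le hC]
    · have hAB : A + B ≤ 6 * D := by linarith
      have hy := amgm hD hb hw (by norm_num : (0 : ℝ) ≤ 4) (h1 hCD)
      nlinarith [mul_nonneg hlam.le (sub_nonneg.2 hAB), mul_nonneg hlam.le hC]

/-- The oracle inequality holds deterministically on the event where the noise is small. -/
lemma refit_oracle_inequality {n p s : ℕ} (hn : 0 < n) {X : Matrix (Fin n) (Fin p) ℝ}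
    {bstar : Fin p → ℝ} (hs : (Finset.univ.filter fun j => bstar j ≠ 0).card = s)
    {κ3 κ1 : ℝ} (hRE3 : RE X 3 s κ3) (hRE1 : RE X 1 s κ1) {lam : ℝ} (hlam : 0 < lam)
    {ε : Fin n → ℝ} (hε : ∀ j, |X.transpose.mulVec ε j / n| ≤ lam / 6)
    {bhat bbar : Fin p → ℝ} (hhat : IsLassoSol X (X.mulVec bstar + ε) lam bhat)
    (hbar : SignConsistentRefit X (X.mulVec bstar + ε) lam bhat bbar) :
    l2sq (X.mulVec (bstar - bbar)) / (n : ℝ) + l2sq (X.mulVec (bstar - bhat)) / (n : ℝ) ≤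
      lam ^ 2 * (s : ℝ) * (9 / κ3 ^ 2 + 16 / κ1 ^ 2) := by
  have hn' : (0 : ℝ) < n := Nat.cast_pos.2 hn
  obtain ⟨hres, hsign⟩ := hbar
  set S : Finset (Fin p) := Finset.univ.filter fun j => bstar j ≠ 0 with hSdef
  have hS : ∀ j ∉ S, bstar j = 0 := fun j hj => by simpa [hSdef] using hj
  set r := X.mulVec bstar + ε - X.mulVec bhat with hr
  set g : Fin p → ℝ := fun j => X.transpose.mulVec r j / n with hgdef
  set W : Fin p → ℝ := fun j => X.transpose.mulVec ε j / n with hWdef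
  have hpair : ∀ (v : Fin n → ℝ) (Δ : Fin p → ℝ),
      (fun j => X.transpose.mulVec v j / (n : ℝ)) ⬝ᵥ Δ = v ⬝ᵥ X.mulVec Δ / n := by
    intro v Δ
    rw [Matrix.dotProduct_mulVec, ← Matrix.mulVec_transpose, dotProduct, dotProduct,
      Finset.sum_div]
    exact Finset.sum_congr rfl fun j _ => by ring
  have hg : ∀ j, |g j| ≤ lam := by
    intro j
    obtain ⟨h1, h2, h3⟩ := hsign j
    rcases lt_trichotomy (bbar j) 0 with h | h | h
    · rw [show g j = -lam from h2 h, abs_neg, abs_of_pos hlam]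
    · exact h3 h
    · rw [show g j = lam from h1 h, abs_of_pos hlam]
  have hgbar : lam * l1 bbar ≤ g ⬝ᵥ bbar := by
    rw [l1, Finset.mul_sum, dotProduct]
    refine Finset.sum_le_sum fun j _ => ?_
    obtain ⟨h1, h2, h3⟩ := hsign j
    rcases lt_trichotomy (bbar j) 0 with h | h | h
    · rw [show g j = -lam from h2 h, abs_of_neg h]
      linarith
    · simp [h]
    · rw [show g j = lam from h1 h, abs_of_pos h]
  have hghat : lam * l1 bhat ≤ g ⬝ᵥ bhat := by
    rw [hgdef, hpair]
    exact hhat.mul_l1_le hn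
  have hbar_le := mul_sub_le_dotProduct_sub hg hgbar hS
  have hhat_le := mul_sub_le_dotProduct_sub hg hghat hS
  set Δb := bbar - bstar with hΔb
  set Δh := bhat - bstar with hΔh
  have hr' : r = ε - X.mulVec Δh := by
    rw [hr, hΔh, Matrix.mulVec_sub]
    abel
  have hrb : X.mulVec bstar + ε - X.mulVec bbar = ε - X.mulVec Δb := by
    rw [hΔb, Matrix.mulVec_sub]
    abel
  have hgW : ∀ Δ : Fin p → ℝ, g ⬝ᵥ Δ = W ⬝ᵥ Δ - X.mulVec Δh ⬝ᵥ X.mulVec Δ / n := by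
    intro Δ
    rw [hgdef, hWdef, hpair, hpair, hr', sub_dotProduct, sub_div]
  have hnorm : ∀ Δ : Fin p → ℝ, l2sq (ε - X.mulVec Δ) / n =
      l2sq ε / n - 2 * (W ⬝ᵥ Δ) + l2sq (X.mulVec Δ) / n := by
    intro Δ
    rw [hWdef, hpair]
    simp only [l2sq_eq_dotProduct, sub_dotProduct, dotProduct_sub]
    rw [dotProduct_comm (X.mulVec Δ) ε]
    ring
  have hnegsq : ∀ b : Fin p → ℝ, l2sq (X.mulVec (bstar - b)) = l2sq (X.mulVec (b - bstar)) := by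
    intro b
    rw [← neg_sub b bstar, Matrix.mulVec_neg]
    simp [l2sq]
  have hfit : l2sq (ε - X.mulVec Δb) / n ≤ l2sq (ε - X.mulVec Δh) / n := by
    rw [← hrb, ← hr']
    gcongr
    exact (Real.sqrt_le_sqrt_iff (l2sq_nonneg _)).1 hres
  rw [hnorm, hnorm] at hfit
  have hcross : 0 ≤ l2sq (X.mulVec Δb) / n + l2sq (X.mulVec Δh) / n +
      2 * (X.mulVec Δh ⬝ᵥ X.mulVec Δb / n) := by
    have h : l2sq (X.mulVec Δb + X.mulVec Δh) / n = l2sq (X.mulVec Δb) / n +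
        l2sq (X.mulVec Δh) / n + 2 * (X.mulVec Δh ⬝ᵥ X.mulVec Δb / n) := by
      simp only [l2sq_eq_dotProduct, add_dotProduct, dotProduct_add]
      rw [dotProduct_comm (X.mulVec Δb) (X.mulVec Δh)]
      ring
    rw [← h]
    exact div_nonneg (l2sq_nonneg _) hn'.le
  have hnoise : W ⬝ᵥ Δb ≤ lam / 6 * (∑ j ∈ Sᶜ, |Δb j| + ∑ j ∈ S, |Δb j|) := by
    rw [add_comm, Finset.sum_add_sum_compl, Finset.mul_sum, dotProduct]
    refine Finset.sum_le_sum fun j _ => (le_abs_self _).trans ?_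
    rw [abs_mul]
    exact mul_le_mul_of_nonneg_right (hε j) (abs_nonneg _)
  have hgh := hgW Δh
  have hgb := hgW Δb
  rw [← l2sq_eq_dotProduct] at hgh
  have hrhs : lam ^ 2 * (s : ℝ) * (9 / κ3 ^ 2 + 16 / κ1 ^ 2) =
      lam ^ 2 * (9 * (s * (1 / κ3 ^ 2)) + 16 * (s * (1 / κ1 ^ 2))) := by ring
  rw [hnegsq, hnegsq, hrhs]
  refine add_le_of_cone_bounds (A := ∑ j ∈ Sᶜ, |Δb j|) (B := ∑ j ∈ S, |Δb j|)
    (C := ∑ j ∈ Sᶜ, |Δh j|) (D := ∑ j ∈ S, |Δh j|)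
    (div_nonneg (l2sq_nonneg _) hn'.le) (div_nonneg (l2sq_nonneg _) hn'.le)
    (Finset.sum_nonneg fun _ _ => abs_nonneg _) (Finset.sum_nonneg fun _ _ => abs_nonneg _)
    (Finset.sum_nonneg fun _ _ => abs_nonneg _) hlam (by positivity) (by positivity)
    (by linarith) ?_ (fun h => hRE3.sum_abs_le hn hs.le h)
    (fun h => hRE1.sum_abs_le hn hs.le (by linarith))
  refine le_of_mul_le_mul_left ?_ hlam
  linarith

theorem stmt3 (n p s : ℕ) (hn : 0 < n) (hp : 0 < p) (σ : ℝ) (hσ : 0 < σ)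
    (X : Matrix (Fin n) (Fin p) ℝ)
    (hX : ∀ j, ∑ i, (X i j) ^ 2 = (n : ℝ))
    (bstar : Fin p → ℝ)
    (hs : (Finset.univ.filter fun j => bstar j ≠ 0).card = s)
    (κ3 κ1 : ℝ) (hRE3 : RE X 3 s κ3) (hRE1 : RE X 1 s κ1)
    (δ : ℝ) (hδ : δ ∈ Set.Ioo (0 : ℝ) 1)
    (lam : ℝ) (hlam : lam = 6 * σ * Real.sqrt (2 * Real.log ((p : ℝ) / δ) / (n : ℝ))) :
    ENNReal.ofReal (1 - δ) ≤
      gaussianVec n σ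
        {ε | ∀ bhat bbar : Fin p → ℝ,
          IsLassoSol X (X.mulVec bstar + ε) lam bhat →
          SignConsistentRefit X (X.mulVec bstar + ε) lam bhat bbar →
          l2sq (X.mulVec (bstar - bbar)) / (n : ℝ) +
              l2sq (X.mulVec (bstar - bhat)) / (n : ℝ) ≤
            lam ^ 2 * (s : ℝ) * (9 / κ3 ^ 2 + 16 / κ1 ^ 2)} := by
  have hlam0 : 0 < lam := by
    have hp' : (1 : ℝ) ≤ p := Nat.one_le_cast.2 hp
    have hlog : 0 < Real.log ((p : ℝ) / δ) :=
      Real.log_pos ((one_lt_div hδ.1).2 (hδ.2.trans_le hp'))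
    rw [hlam]
    positivity
  refine (gaussianVec_noise_le hn hp hσ X hX hδ).trans (measure_mono ?_)
  intro ε hε bhat bbar hhat hbar
  refine refit_oracle_inequality hn hs hRE3 hRE1 hlam0 (fun j => (hε j).trans_eq ?_) hhat hbar
  rw [hlam]
  ring
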